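/- Let (P_t)_{t≥0} be a Feller, stochastically continuous Markov transition semigroup on a Polish metric space 𝒳 with the e-property, and suppose there exists z ∈ 𝒳 such that liminf_{T→∞} Q^T(x, B(z,δ)) > 0 for every δ > 0 and every x ∈ 𝒳. Then for all x₁, x₂ ∈ 𝒯 and every bounded Lipschitz function ψ on 𝒳, lim_{T→∞} | ∫ ψ(y) Q^T(x₁,dy) − ∫ ψ(y) Q^T(x₂,dy) | = 0. -/

import Mathlib

open MeasureTheory Filter Topology Metric Set

noncomputable section

/-- A Markov transition semigroup on a measurable space `X`: a jointly measurable family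
of Markov probability kernels `P t x` with `P 0 x = δ_x` and the Chapman–Kolmogorov
semigroup property for nonnegative times. -/
structure MarkovSemigroup (X : Type*) [MeasurableSpace X] where
  P : ℝ → X → MeasureTheory.Measure X
  prob : ∀ t x, MeasureTheory.IsProbabilityMeasure (P t x)
  meas : Measurable fun p : ℝ × X => P p.1 p.2
  init : ∀ x : X, P 0 x = MeasureTheory.Measure.dirac x
  semigroup : ∀ t s : ℝ, 0 ≤ t → 0 ≤ s → ∀ x : X,
    P (t + s) x = (P t x).bind (P s)

namespace MarkovSemigroup

variable {X : Type*} [MeasurableSpace X]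

/-- Action `P_t f(x) = ∫ f(y) P_t(x,dy)` on functions. -/
def act (M : MarkovSemigroup X) (t : ℝ) (f : X → ℝ) (x : X) : ℝ :=
  ∫ y, f y ∂(M.P t x)

/-- Dual action `P_t^* μ` on measures. -/
def dual (M : MarkovSemigroup X) (t : ℝ) (μ : MeasureTheory.Measure X) :
    MeasureTheory.Measure X :=
  μ.bind (M.P t)

/-- The time average `Q^T μ = (1/T) ∫_0^T P_s^* μ ds` (with the convention
`Q^T μ = μ` for `T ≤ 0`). -/
def QM (M : MarkovSemigroup X) (T : ℝ) (μ : MeasureTheory.Measure X) :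
    MeasureTheory.Measure X :=
  if T ≤ 0 then μ
  else ((ENNReal.ofReal (1 / T)) • (volume.restrict (Set.Ioc (0 : ℝ) T))).bind
    fun s => M.dual s μ

/-- `Q^T(x,·) := Q^T δ_x`. -/
def Q (M : MarkovSemigroup X) (T : ℝ) (x : X) : MeasureTheory.Measure X :=
  M.QM T (MeasureTheory.Measure.dirac x)

/-- Iterated averages: for `ts = [t_k, …, t_1]`, `QMs ts μ = Q^{t_k}(⋯(Q^{t_1} μ)⋯)`. -/
def QMs (M : MarkovSemigroup X) (ts : List ℝ) (μ : MeasureTheory.Measure X) :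
    MeasureTheory.Measure X :=
  ts.foldr (fun t ν => M.QM t ν) μ

/-- A measure is invariant if `P_t^* μ = μ` for all `t ≥ 0`. -/
def Invariant (M : MarkovSemigroup X) (μ : MeasureTheory.Measure X) : Prop :=
  ∀ t : ℝ, 0 ≤ t → M.dual t μ = μ

section TopologicalDefs

variable [TopologicalSpace X]

/-- Bounded continuous real functions. -/
def IsBddContinuous (f : X → ℝ) : Prop :=
  Continuous f ∧ ∃ C : ℝ, ∀ x, |f x| ≤ C

/-- The Feller property: `P_t` maps bounded continuous functions to continuous ones. -/
def Feller (M : MarkovSemigroup X) : Prop :=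
  ∀ t : ℝ, 0 ≤ t → ∀ f : X → ℝ, MarkovSemigroup.IsBddContinuous f →
    Continuous (M.act t f)

/-- Stochastic continuity: `P_t f(x) → f(x)` as `t → 0+`. -/
def StochasticallyContinuous (M : MarkovSemigroup X) : Prop :=
  ∀ f : X → ℝ, MarkovSemigroup.IsBddContinuous f → ∀ x : X,
    Filter.Tendsto (fun t : ℝ => M.act t f x) (nhdsWithin 0 (Set.Ioi 0)) (nhds (f x))

/-- Weak convergence of `Q^T ν` to `μ` as `T → ∞`. -/
def QTendsto (M : MarkovSemigroup X) (ν μ : MeasureTheory.Measure X) : Prop :=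
  ∀ f : X → ℝ, MarkovSemigroup.IsBddContinuous f →
    Filter.Tendsto (fun T : ℝ => ∫ x, f x ∂(M.QM T ν)) Filter.atTop
      (nhds (∫ x, f x ∂μ))

/-- Weak-* mean ergodicity with limit `μstar`. -/
def WeakStarMeanErgodic (M : MarkovSemigroup X) (μstar : MeasureTheory.Measure X) : Prop :=
  ∀ ν : MeasureTheory.Measure X, MeasureTheory.IsProbabilityMeasure ν → M.QTendsto ν μstar

/-- Tightness of the family `(Q^T(x,·))_{T>0}`. -/
def TightAt (M : MarkovSemigroup X) (x : X) : Prop :=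
  ∀ ε : ℝ, 0 < ε → ∃ K : Set X, IsCompact K ∧
    ∀ T : ℝ, 0 < T → 1 - ε ≤ ((M.Q T x) K).toReal

end TopologicalDefs

end MarkovSemigroup

/-- Topological support of a measure: points all of whose open neighborhoods
have positive mass. -/
def msupport {X : Type*} [MeasurableSpace X] [TopologicalSpace X]
    (μ : MeasureTheory.Measure X) : Set X :=
  {x : X | ∀ U : Set X, IsOpen U → x ∈ U → 0 < μ U}

/-- Total variation distance between two (finite) measures, as the supremum over
Borel sets of the discrepancy of masses. -/
def tvDist {X : Type*} [MeasurableSpace X] (μ ν : MeasureTheory.Measure X) : ℝ :=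
  ⨆ B : {B : Set X // MeasurableSet B}, |(μ B.1).toReal - (ν B.1).toReal|

section MetricDefs

variable {X : Type*} [MeasurableSpace X] [PseudoMetricSpace X]

/-- Bounded Lipschitz real functions. -/
def IsBddLipschitz (ψ : X → ℝ) : Prop :=
  (∃ K : NNReal, LipschitzWith K ψ) ∧ ∃ C : ℝ, ∀ x, |ψ x| ≤ C

/-- The e-property: equicontinuity of `(P_t ψ)_{t ≥ 0}` at every point, for every
bounded Lipschitz `ψ`. -/
def MarkovSemigroup.EProperty (M : MarkovSemigroup X) : Prop :=
  ∀ ψ : X → ℝ, IsBddLipschitz ψ → ∀ x : X, ∀ ε : ℝ, 0 < ε →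
    ∃ δ : ℝ, 0 < δ ∧ ∀ z : X, dist z x < δ → ∀ t : ℝ, 0 ≤ t →
      |M.act t ψ z - M.act t ψ x| < ε

end MetricDefs

namespace MarkovSemigroup

section Measurable

variable {X : Type*} [MeasurableSpace X] (M : MarkovSemigroup X) {f : X → ℝ} {C : ℝ}

instance (t : ℝ) (x : X) : IsProbabilityMeasure (M.P t x) := M.prob t x

/-- The transition probabilities as a kernel jointly in time and space. -/
def jointKernel : ProbabilityTheory.Kernel (ℝ × X) X := ⟨fun p => M.P p.1 p.2, M.meas⟩

instance : ProbabilityTheory.IsMarkovKernel M.jointKernel := ⟨fun p => M.prob p.1 p.2⟩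

lemma measurable_P (t : ℝ) : Measurable (M.P t) := M.meas.comp measurable_prodMk_left

lemma measurable_P_time (x : X) : Measurable fun t => M.P t x :=
  M.meas.comp measurable_prodMk_right

lemma measurable_act_joint (hf : Measurable f) :
    Measurable fun p : ℝ × X => M.act p.1 f p.2 :=
  (hf.stronglyMeasurable.integral_kernel (κ := M.jointKernel)).measurable

lemma measurable_act (hf : Measurable f) (t : ℝ) : Measurable (M.act t f) :=
  (M.measurable_act_joint hf).comp measurable_prodMk_left

lemma measurable_act_time (hf : Measurable f) (x : X) : Measurable fun t => M.act t f x :=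
  (M.measurable_act_joint hf).comp measurable_prodMk_right

lemma integrable_of_abs_le {α : Type*} [MeasurableSpace α] {μ : Measure α} [IsFiniteMeasure μ]
    {g : α → ℝ} (hg : Measurable g) (hC : ∀ a, |g a| ≤ C) : Integrable g μ :=
  Integrable.of_bound hg.aestronglyMeasurable C (Eventually.of_forall hC)

lemma abs_integral_le {α : Type*} [MeasurableSpace α] {μ : Measure α} [IsProbabilityMeasure μ]
    {g : α → ℝ} (hC : ∀ a, |g a| ≤ C) : |∫ a, g a ∂μ| ≤ C := by
  simpa using norm_integral_le_of_norm_le_const (μ := μ) (f := g) (Eventually.of_forall hC)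

lemma abs_act_le (hC : ∀ x, |f x| ≤ C) (t : ℝ) (x : X) : |M.act t f x| ≤ C :=
  abs_integral_le hC

lemma integral_bind_of_abs_le {α β : Type*} [MeasurableSpace α] [MeasurableSpace β]
    {μ : Measure α} [IsFiniteMeasure μ] {κ : α → Measure β} (hκ : Measurable κ)
    (hprob : ∀ a, IsProbabilityMeasure (κ a)) {g : β → ℝ} (hg : Measurable g)
    (hC : ∀ b, |g b| ≤ C) : ∫ b, g b ∂(μ.bind κ) = ∫ a, ∫ b, g b ∂(κ a) ∂μ := by
  let η : ProbabilityTheory.Kernel α β := ⟨κ, hκ⟩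
  have : ProbabilityTheory.IsMarkovKernel η := ⟨hprob⟩
  change ∫ b, g b ∂(μ.bind η) = ∫ a, ∫ b, g b ∂(η a) ∂μ
  have hint : Integrable g (μ.bind η) := integrable_of_abs_le hg hC
  rw [Measure.comp_eq_comp_const_apply] at hint ⊢
  rw [ProbabilityTheory.Kernel.integral_comp hint]
  simp

lemma act_act (hf : Measurable f) (hC : ∀ x, |f x| ≤ C) {s t : ℝ} (hs : 0 ≤ s) (ht : 0 ≤ t)
    (x : X) : M.act s (M.act t f) x = M.act (s + t) f x := by
  simp only [act, M.semigroup s t hs ht x]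
  rw [integral_bind_of_abs_le (M.measurable_P t) (M.prob t) hf hC]

lemma Q_eq_bind {T : ℝ} (hT : 0 < T) (x : X) :
    M.Q T x = ((ENNReal.ofReal (1 / T)) • (volume.restrict (Set.Ioc (0 : ℝ) T))).bind
      fun s => M.P s x := by
  simp [Q, QM, dual, not_le.2 hT, Measure.dirac_bind (M.measurable_P _)]

lemma isProbabilityMeasure_Q {T : ℝ} (hT : 0 < T) (x : X) : IsProbabilityMeasure (M.Q T x) := by
  constructor
  rw [M.Q_eq_bind hT, Measure.bind_apply .univ (M.measurable_P_time x).aemeasurable]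
  simp [← ENNReal.ofReal_mul, hT.le, hT.ne']

lemma integral_Q (hf : Measurable f) (hC : ∀ x, |f x| ≤ C) {T : ℝ} (hT : 0 < T) (x : X) :
    ∫ y, f y ∂(M.Q T x) = 1 / T * ∫ s in (0 : ℝ)..T, M.act s f x := by
  have : IsFiniteMeasure (ENNReal.ofReal (1 / T) • volume.restrict (Set.Ioc (0 : ℝ) T)) :=
    Measure.smul_finite _ ENNReal.ofReal_ne_top
  rw [M.Q_eq_bind hT, integral_bind_of_abs_le (M.measurable_P_time x) (fun s => M.prob s x) hf hC,
    integral_smul_measure, ENNReal.toReal_ofReal (by positivity),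
    intervalIntegral.integral_of_le hT.le]
  rfl

lemma intervalIntegrable_act (hf : Measurable f) (hC : ∀ x, |f x| ≤ C) (x : X) (a b : ℝ) :
    IntervalIntegrable (fun s => M.act s f x) volume a b := by
  constructor <;>
  exact integrable_of_abs_le (M.measurable_act_time hf x) fun s => M.abs_act_le hC s x

lemma integral_Q_act (hf : Measurable f) (hC : ∀ x, |f x| ≤ C) {T u : ℝ} (hT : 0 < T)
    (hu : 0 ≤ u) (x : X) :
    ∫ y, M.act u f y ∂(M.Q T x) = 1 / T * ∫ s in (0 : ℝ)..T, M.act (s + u) f x := by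
  rw [M.integral_Q (M.measurable_act hf u) (M.abs_act_le hC u) hT]
  congr 1
  refine intervalIntegral.integral_congr fun s hs => ?_
  rw [uIcc_of_le hT.le] at hs
  exact M.act_act hf hC hs.1 hu x

lemma abs_integral_Q_act_sub_le (hf : Measurable f) (hC : ∀ x, |f x| ≤ C) {T u : ℝ} (hT : 0 < T)
    (hu : 0 ≤ u) (x : X) :
    |∫ y, M.act u f y ∂(M.Q T x) - ∫ y, f y ∂(M.Q T x)| ≤ 2 * C * u / T := by
  have hi := fun a b => M.intervalIntegrable_act hf hC x a b
  have hb : ∀ a, |∫ s in a..(a + u), M.act s f x| ≤ C * u := fun a => by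
    simpa [abs_of_nonneg hu] using intervalIntegral.norm_integral_le_of_norm_le_const
      (a := a) (b := a + u) (f := fun s => M.act s f x) (C := C)
      fun s _ => M.abs_act_le hC s x
  rw [M.integral_Q_act hf hC hT hu, M.integral_Q hf hC hT, ← mul_sub,
    intervalIntegral.integral_comp_add_right (fun s => M.act s f x),
    intervalIntegral.integral_interval_sub_interval_comm (hi _ _) (hi _ _) (hi _ _),
    abs_mul, abs_of_pos (by positivity : 0 < 1 / T), one_div, ← div_eq_inv_mul]
  gcongr
  rw [intervalIntegral.integral_symm 0, intervalIntegral.integral_symm T, zero_add]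
  have h0 := hb 0
  have hT' := hb T
  rw [zero_add] at h0
  rw [abs_le] at *
  constructor <;> linarith

lemma tendsto_integral_Q_act_sub (hf : Measurable f) (hC : ∀ x, |f x| ≤ C) {u : ℝ}
    (hu : 0 ≤ u) (x : X) :
    Tendsto (fun T => ∫ y, M.act u f y ∂(M.Q T x) - ∫ y, f y ∂(M.Q T x)) atTop (𝓝 0) := by
  refine squeeze_zero_norm' (a := fun T => 2 * C * u / T) ?_ (tendsto_id.const_div_atTop _)
  filter_upwards [eventually_gt_atTop 0] with T hT
  exact M.abs_integral_Q_act_sub_le hf hC hT hu x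

lemma measurable_integral_Q (hf : Measurable f) (hC : ∀ x, |f x| ≤ C) {T : ℝ} (hT : 0 < T) :
    Measurable fun x => ∫ y, f y ∂(M.Q T x) := by
  simp_rw [M.integral_Q hf hC hT, intervalIntegral.integral_of_le hT.le]
  exact ((M.measurable_act_joint hf).comp measurable_swap).stronglyMeasurable.integral_prod_right'
    |>.measurable.const_mul _

lemma abs_integral_Q_le (hC : ∀ x, |f x| ≤ C) {T : ℝ} (hT : 0 < T) (x : X) :
    |∫ y, f y ∂(M.Q T x)| ≤ C :=
  have := M.isProbabilityMeasure_Q hT x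
  abs_integral_le hC

lemma act_integral_Q (hf : Measurable f) (hC : ∀ x, |f x| ≤ C) {T u : ℝ} (hT : 0 < T)
    (hu : 0 ≤ u) (x : X) :
    M.act u (fun y => ∫ w, f w ∂(M.Q T y)) x = ∫ y, M.act u f y ∂(M.Q T x) := by
  rw [M.integral_Q_act hf hC hT hu]
  simp only [act, M.integral_Q hf hC hT, intervalIntegral.integral_of_le hT.le]
  rw [integral_const_mul, integral_integral_swap]
  · congr 1
    refine setIntegral_congr_fun measurableSet_Ioc fun s hs => ?_
    rw [add_comm]
    exact M.act_act hf hC hu hs.1.le x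
  · exact integrable_of_abs_le ((M.measurable_act_joint hf).comp measurable_swap)
      fun p => M.abs_act_le hC _ _

lemma abs_sub_sq_le {a b : ℝ} (ha : |a| ≤ C) (hb : |b| ≤ C) : |(a - b) ^ 2| ≤ (2 * C) ^ 2 := by
  rw [abs_pow]
  exact pow_le_pow_left₀ (abs_nonneg _) (by linarith [abs_sub a b]) 2

/-- The second moment of a function about its value `h y` under the transition law `P_s(y,·)`
measures the defect of invariance of `(h - c)²` when `h` is harmonic. -/
lemma act_sq_sub_eq {h : X → ℝ} (hh : Measurable h) (hC : ∀ x, |h x| ≤ C) {s : ℝ} {y : X}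
    (hinv : M.act s h y = h y) (c : ℝ) :
    M.act s (fun w => (h w - c) ^ 2) y = ∫ w, (h w - h y) ^ 2 ∂(M.P s y) + (h y - c) ^ 2 := by
  have hi : Integrable h (M.P s y) := integrable_of_abs_le hh hC
  have hi2 : Integrable (fun w => (h w - h y) ^ 2) (M.P s y) :=
    integrable_of_abs_le (by fun_prop) fun w => abs_sub_sq_le (hC w) (hC y)
  have he : (fun w => (h w - c) ^ 2) = fun w =>
      ((h w - h y) ^ 2 + 2 * (h y - c) * h w) + ((h y - c) ^ 2 - 2 * (h y - c) * h y) := by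
    ext w; ring
  unfold act at hinv ⊢
  have hi3 : Integrable (fun w => (h w - h y) ^ 2 + 2 * (h y - c) * h w) (M.P s y) :=
    hi2.add (hi.const_mul _)
  rw [he, integral_add hi3 (integrable_const _), integral_add hi2 (hi.const_mul _), integral_const_mul, hinv]
  simp

lemma exists_P_pos_of_Q_pos {T : ℝ} (hT : 0 < T) {x : X} {B : Set X} (hB : MeasurableSet B)
    (hpos : 0 < M.Q T x B) : ∃ s, 0 ≤ s ∧ 0 < M.P s x B := by
  by_contra! hcon
  refine hpos.ne' ?_
  rw [M.Q_eq_bind hT, Measure.bind_apply hB (M.measurable_P_time x).aemeasurable,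
    lintegral_smul_measure, setLIntegral_congr_fun measurableSet_Ioc
      (g := fun _ => 0) fun s hs => by simpa using hcon s hs.1.le]
  simp

end Measurable

section Topological

variable {X : Type*} [MetricSpace X] [MeasurableSpace X] [BorelSpace X]
  (M : MarkovSemigroup X)

/-- A bounded continuous harmonic function takes at a point of tightness the same value as at a
point all of whose neighbourhoods are charged by the ergodic averages. -/
lemma eq_of_harmonic_of_tightAt (hFeller : M.Feller) {z : X}
    (hlow : ∀ δ : ℝ, 0 < δ → ∀ x : X, ∃ T, 0 < T ∧ 0 < M.Q T x (ball z δ))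
    {h : X → ℝ} (hh : Continuous h) {C : ℝ} (hC : ∀ x, |h x| ≤ C)
    (hinv : ∀ t, 0 ≤ t → ∀ x, M.act t h x = h x) {x : X} (hx : M.TightAt x) : h x = h z := by
  set g : X → ℝ := fun w => (h w - h z) ^ 2 with hg
  have hgc : Continuous g := by fun_prop
  have hg0 : ∀ w, 0 ≤ g w := fun w => sq_nonneg _
  set G : ℝ := (2 * C) ^ 2
  have hgabs : ∀ w, |g w| ≤ G := fun w => abs_sub_sq_le (hC w) (hC z)
  have hgG : ∀ w, g w ≤ G := fun w => (le_abs_self _).trans (hgabs w)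
  have hG0 : 0 ≤ G := sq_nonneg _
  have hle : ∀ s, 0 ≤ s → ∀ y, g y ≤ M.act s g y := fun s hs y => by
    rw [hg, M.act_sq_sub_eq hh.measurable hC (hinv s hs y)]
    exact le_add_of_nonneg_left (integral_nonneg fun w => sq_nonneg _)
  have hlt : ∀ y, 0 < g y → ∃ s, 0 ≤ s ∧ g y < M.act s g y := fun y hy => by
    have hne : h z ≠ h y := fun he => by simp [hg, he] at hy
    obtain ⟨δ, hδ, hball⟩ := Metric.mem_nhds_iff.1 (hh.continuousAt.eventually_ne hne)
    obtain ⟨T, hT, hQ⟩ := hlow δ hδ y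
    obtain ⟨s, hs, hP⟩ := M.exists_P_pos_of_Q_pos hT measurableSet_ball hQ
    refine ⟨s, hs, ?_⟩
    rw [hg, M.act_sq_sub_eq hh.measurable hC (hinv s hs y)]
    refine lt_add_of_pos_left _ ?_
    rw [integral_pos_iff_support_of_nonneg (fun w => sq_nonneg _)]
    · refine hP.trans_le (measure_mono fun w hw => ?_)
      simpa [sub_eq_zero] using hball hw
    · exact integrable_of_abs_le ((hh.measurable.sub_const _).pow_const _)
        fun w => abs_sub_sq_le (hC w) (hC y)
  have hgQ : ∀ T, 0 < T → g x ≤ ∫ y, g y ∂(M.Q T x) := fun T hT => by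
    rw [M.integral_Q hgc.measurable hgabs hT]
    have : ∫ _ in (0 : ℝ)..T, g x ≤ ∫ s in (0 : ℝ)..T, M.act s g x :=
      intervalIntegral.integral_mono_on hT.le (by simp)
        (M.intervalIntegrable_act hgc.measurable hgabs x _ _) fun s hs => hle s hs.1 x
    rw [intervalIntegral.integral_const, sub_zero, smul_eq_mul] at this
    rw [one_div, ← div_eq_inv_mul, le_div_iff₀' hT]
    exact this
  have hzero : ∀ K : Set X, IsCompact K → (∀ y ∈ K, 0 < g y) →
      Tendsto (fun T => (M.Q T x).real K) atTop (𝓝 0) := by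
    intro K hK hpos
    have hmono : ∀ ⦃s t : Set X⦄, s ⊆ t → Tendsto (fun T => (M.Q T x).real t) atTop (𝓝 0) →
        Tendsto (fun T => (M.Q T x).real s) atTop (𝓝 0) := fun s t hst ht => by
      refine squeeze_zero' (Eventually.of_forall fun T => measureReal_nonneg) ?_ ht
      filter_upwards [eventually_gt_atTop 0] with T hT
      have := M.isProbabilityMeasure_Q hT x
      exact measureReal_mono hst
    refine hK.induction_on (p := fun S => Tendsto (fun T => (M.Q T x).real S) atTop (𝓝 0))
      (by simp) hmono ?_ ?_
    · intro s t hs ht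
      refine squeeze_zero (fun T => measureReal_nonneg) (fun T => measureReal_union_le _ _)
        (by simpa using hs.add ht)
    · intro y hy
      obtain ⟨s, hs, hlt⟩ := hlt y (hpos y hy)
      set D : X → ℝ := fun w => M.act s g w - g w with hD
      have hDc : Continuous D := (hFeller s hs g ⟨hgc, G, hgabs⟩).sub hgc
      have hD0 : ∀ w, 0 ≤ D w := fun w => sub_nonneg.2 (hle s hs w)
      have hDy : 0 < D y := sub_pos.2 hlt
      refine ⟨{w | D y / 2 ≤ D w}, mem_nhdsWithin_of_mem_nhds ?_, ?_⟩
      · filter_upwards [hDc.continuousAt.eventually (lt_mem_nhds (half_lt_self hDy))] with w hw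
        exact hw.le
      · have hlim := (M.tendsto_integral_Q_act_sub hgc.measurable hgabs hs x).const_mul (D y / 2)⁻¹
        rw [mul_zero] at hlim
        refine squeeze_zero' (Eventually.of_forall fun T => measureReal_nonneg) ?_ hlim
        filter_upwards [eventually_gt_atTop 0] with T hT
        have := M.isProbabilityMeasure_Q hT x
        have hi1 : Integrable (M.act s g) (M.Q T x) :=
          integrable_of_abs_le (M.measurable_act hgc.measurable s) (M.abs_act_le hgabs s)
        have hi2 : Integrable g (M.Q T x) := integrable_of_abs_le hgc.measurable hgabs
        rw [← integral_sub hi1 hi2, ← div_eq_inv_mul, le_div_iff₀' (half_pos hDy)]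
        exact mul_meas_ge_le_integral_of_nonneg (Eventually.of_forall hD0) (hi1.sub hi2) _
  have key : ∀ ε, 0 < ε → g x ≤ ε + G * ε := by
    intro ε hε
    obtain ⟨K, hK, hKT⟩ := hx ε hε
    set L := K ∩ {y | ε ≤ g y}
    have hLc : IsCompact L := hK.inter_right (isClosed_le continuous_const hgc)
    have hlim := ((hzero L hLc fun y hy => hε.trans_le hy.2).const_mul G).const_add (ε + G * ε)
    rw [mul_zero, add_zero] at hlim
    refine ge_of_tendsto hlim ?_
    filter_upwards [eventually_gt_atTop 0] with T hT
    have := M.isProbabilityMeasure_Q hT x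
    have hKm := hK.isClosed.measurableSet
    have hLm := hLc.isClosed.measurableSet
    have hiK : Integrable (Kᶜ.indicator fun _ => G) (M.Q T x) :=
      (integrable_const G).indicator hKm.compl
    have hiL : Integrable (L.indicator fun _ => G) (M.Q T x) := (integrable_const G).indicator hLm
    have hiεK : Integrable (fun y => ε + Kᶜ.indicator (fun _ => G) y) (M.Q T x) :=
      (integrable_const ε).add hiK
    have hpt : ∀ y, g y ≤ ε + Kᶜ.indicator (fun _ => G) y + L.indicator (fun _ => G) y := by
      intro y
      by_cases hyK : y ∈ K
      · by_cases hyg : ε ≤ g y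
        · have : y ∈ L := ⟨hyK, hyg⟩
          simp only [mem_compl_iff, hyK, not_true_eq_false, not_false_eq_true,
            indicator_of_notMem, indicator_of_mem this]
          linarith [hgG y]
        · have : y ∉ L := fun hy => hyg hy.2
          simp only [mem_compl_iff, hyK, not_true_eq_false, not_false_eq_true,
            indicator_of_notMem, this]
          linarith
      · have : y ∉ L := fun hy => hyK hy.1
        simp only [mem_compl_iff, hyK, not_false_eq_true, indicator_of_mem,
            indicator_of_notMem this]
        linarith [hgG y]
    have hcompl : (M.Q T x).real Kᶜ ≤ ε := by
      have h1 := hKT T hT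
      rw [probReal_compl_eq_one_sub hKm]
      rw [← measureReal_def] at h1
      linarith
    calc g x ≤ ∫ y, g y ∂(M.Q T x) := hgQ T hT
      _ ≤ ∫ y, (ε + Kᶜ.indicator (fun _ => G) y + L.indicator (fun _ => G) y) ∂(M.Q T x) :=
        integral_mono (integrable_of_abs_le hgc.measurable hgabs)
          (hiεK.add hiL) hpt
      _ = ε + G * (M.Q T x).real Kᶜ + G * (M.Q T x).real L := by
        rw [integral_add hiεK hiL, integral_add (integrable_const ε) hiK,
          integral_indicator_const _ hKm.compl, integral_indicator_const _ hLm]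
        simp [mul_comm]
      _ ≤ ε + G * ε + G * (M.Q T x).real L := by gcongr
  have hlim : Tendsto (fun ε : ℝ => ε + G * ε) (𝓝[>] 0) (𝓝 0) :=
    (Continuous.tendsto' (by fun_prop) 0 0 (by simp)).mono_left nhdsWithin_le_nhds
  have hgx : g x ≤ 0 := ge_of_tendsto hlim (eventually_nhdsWithin_of_forall fun ε hε => key ε hε)
  exact sub_eq_zero.1 (pow_eq_zero_iff two_ne_zero |>.1 (le_antisymm hgx (hg0 x)))

lemma exists_dist_integral_Q_le (hE : M.EProperty) {ψ : X → ℝ} (hψ : IsBddLipschitz ψ) (x : X)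
    {ε : ℝ} (hε : 0 < ε) : ∃ δ > 0, ∀ y, dist y x < δ → ∀ T, 0 < T →
      |∫ w, ψ w ∂(M.Q T y) - ∫ w, ψ w ∂(M.Q T x)| ≤ ε := by
  obtain ⟨⟨K, hK⟩, C, hC⟩ := id hψ
  have hm := hK.continuous.measurable
  obtain ⟨δ, hδ, hδE⟩ := hE ψ hψ x ε hε
  refine ⟨δ, hδ, fun y hy T hT => ?_⟩
  rw [M.integral_Q hm hC hT, M.integral_Q hm hC hT, ← mul_sub, ← intervalIntegral.integral_sub
    (M.intervalIntegrable_act hm hC y _ _) (M.intervalIntegrable_act hm hC x _ _), abs_mul,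
    abs_of_pos (by positivity : 0 < 1 / T), one_div, ← div_eq_inv_mul, div_le_iff₀ hT]
  have := intervalIntegral.norm_integral_le_of_norm_le_const (a := 0) (b := T) (C := ε)
    (f := fun s => M.act s ψ y - M.act s ψ x) fun s hs => by
      rw [uIoc_of_le hT.le] at hs
      exact (hδE y hy s hs.1.le).le
  simpa [abs_of_pos hT] using this

/-- Under the e-property, ergodic averages of a bounded Lipschitz observable converge pointwise
along a subsequence to a bounded continuous harmonic function. -/
lemma exists_subseq_tendsto_harmonic [TopologicalSpace.SeparableSpace X] (hE : M.EProperty) {ψ : X → ℝ}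
    (hψ : IsBddLipschitz ψ) {u : ℕ → ℝ} (hu : Tendsto u atTop atTop) :
    ∃ φ : ℕ → ℕ, StrictMono φ ∧ ∃ h : X → ℝ, Continuous h ∧ (∃ C, ∀ x, |h x| ≤ C) ∧
      (∀ t, 0 ≤ t → ∀ x, M.act t h x = h x) ∧
      ∀ x, Tendsto (fun n => ∫ y, ψ y ∂(M.Q (u (φ n)) x)) atTop (𝓝 (h x)) := by
  obtain ⟨⟨K, hK⟩, C, hC⟩ := id hψ
  have hm := hK.continuous.measurable
  rcases isEmpty_or_nonempty X with hX | hX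
  · exact ⟨id, strictMono_id, 0, continuous_const, ⟨0, by simp⟩, fun _ _ x => hX.elim x,
      fun x => hX.elim x⟩
  set F : ℝ → X → ℝ := fun T x => ∫ y, ψ y ∂(M.Q T x) with hF
  set d := TopologicalSpace.denseSeq X
  obtain ⟨N, hN⟩ := eventually_atTop.1 (hu.eventually_gt_atTop 0)
  have hcpt : IsCompact (Set.pi univ fun _ : ℕ => Icc (-C) C) :=
    isCompact_univ_pi fun _ => isCompact_Icc
  obtain ⟨a, -, φ₀, hφ₀, ha⟩ := hcpt.tendsto_subseq (x := fun n i => F (u (n + N)) (d i))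
    fun n i _ => abs_le.1 (M.abs_integral_Q_le hC (hN _ (by omega)) _)
  rw [tendsto_pi_nhds] at ha
  set φ : ℕ → ℕ := fun n => φ₀ n + N with hφ
  have hφm : StrictMono φ := fun m n hmn => by simpa [hφ] using hφ₀ hmn
  have hpos : ∀ n, 0 < u (φ n) := fun n => hN _ (by simp [hφ])
  have hcauchy : ∀ x, ∃ b, Tendsto (fun n => F (u (φ n)) x) atTop (𝓝 b) := by
    intro x
    refine cauchySeq_tendsto_of_complete (Metric.cauchySeq_iff.2 fun ε hε => ?_)
    obtain ⟨δ, hδ, hδE⟩ := M.exists_dist_integral_Q_le hE hψ x (ε := ε / 3) (by positivity)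
    obtain ⟨i, hi⟩ := (TopologicalSpace.denseRange_denseSeq X).exists_dist_lt x hδ
    rw [dist_comm] at hi
    obtain ⟨m, hm⟩ := Metric.cauchySeq_iff.1 (ha i).cauchySeq (ε / 3) (by positivity)
    refine ⟨m, fun j hj k hk => ?_⟩
    have h1 := hδE _ hi _ (hpos j)
    have h2 := hδE _ hi _ (hpos k)
    have h3 := hm j hj k hk
    simp only [Real.dist_eq, Function.comp_apply] at h3 ⊢
    change |F (u (φ j)) (d i) - F (u (φ k)) (d i)| < _ at h3
    change |F (u (φ j)) (d i) - F (u (φ j)) x| ≤ _ at h1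
    change |F (u (φ k)) (d i) - F (u (φ k)) x| ≤ _ at h2
    rw [abs_lt] at *
    rw [abs_le] at *
    constructor <;> linarith
  choose h hh using hcauchy
  have hFC : ∀ n x, |F (u (φ n)) x| ≤ C := fun n x => M.abs_integral_Q_le hC (hpos n) x
  have huφ : Tendsto (fun n => u (φ n)) atTop atTop := hu.comp hφm.tendsto_atTop
  refine ⟨φ, hφm, h, ?_, ⟨C, fun x => le_of_tendsto (hh x).abs
    (Eventually.of_forall fun n => hFC n x)⟩, ?_, hh⟩
  · refine Metric.continuous_iff.2 fun x ε hε => ?_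
    obtain ⟨δ, hδ, hδE⟩ := M.exists_dist_integral_Q_le hE hψ x (half_pos hε)
    refine ⟨δ, hδ, fun y hy => lt_of_le_of_lt ?_ (half_lt_self hε)⟩
    exact le_of_tendsto ((hh y).sub (hh x)).abs
      (Eventually.of_forall fun n => hδE y hy _ (hpos n))
  · intro t ht x
    have h1 : Tendsto (fun n => M.act t (F (u (φ n))) x) atTop (𝓝 (M.act t h x)) :=
      tendsto_integral_of_dominated_convergence (fun _ => C)
        (fun n => (M.measurable_integral_Q hm hC (hpos n)).aestronglyMeasurable)
        (integrable_const C) (fun n => Eventually.of_forall (hFC n)) (Eventually.of_forall hh)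
    have h2 := ((M.tendsto_integral_Q_act_sub hm hC ht x).comp huφ).add (hh x)
    rw [zero_add] at h2
    refine tendsto_nhds_unique h1 (h2.congr fun n => ?_)
    simp [hF, M.act_integral_Q hm hC (hpos n) ht]

end Topological

end MarkovSemigroup

/-- equation (U1) in the proof of Theorem 1. Under the e-property and
the lower bound condition at `z`, the ergodic averages of a bounded Lipschitz observable
started at any two points of `𝒯` asymptotically coincide. -/
theorem ergodic_averages_coincide_on_tight_points
    {X : Type*} [MetricSpace X] [CompleteSpace X] [SecondCountableTopology X]
    [MeasurableSpace X] [BorelSpace X]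
    (M : MarkovSemigroup X)
    (hFeller : M.Feller) (hSC : M.StochasticallyContinuous) (hE : M.EProperty)
    (z : X)
    (hlow : ∀ δ : ℝ, 0 < δ → ∀ x : X,
      0 < Filter.liminf (fun T : ℝ => ((M.Q T x) (Metric.ball z δ)).toReal)
        Filter.atTop) :
    ∀ x₁ x₂ : X, M.TightAt x₁ → M.TightAt x₂ →
      ∀ ψ : X → ℝ, IsBddLipschitz ψ →
        Filter.Tendsto
          (fun T : ℝ => |(∫ y, ψ y ∂(M.Q T x₁)) - (∫ y, ψ y ∂(M.Q T x₂))|)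
          Filter.atTop (nhds 0) := by
  intro x₁ x₂ hx₁ hx₂ ψ hψ
  have hcharge : ∀ δ : ℝ, 0 < δ → ∀ x : X, ∃ T, 0 < T ∧ 0 < M.Q T x (ball z δ) := by
    intro δ hδ x
    have hev := eventually_lt_of_lt_liminf (hlow δ hδ x)
      (isBoundedUnder_of ⟨0, fun T => ENNReal.toReal_nonneg⟩)
    obtain ⟨T, hpos, hT⟩ := (hev.and (eventually_gt_atTop 0)).exists
    exact ⟨T, hT, (ENNReal.toReal_pos_iff.1 hpos).1⟩
  refine tendsto_of_subseq_tendsto fun u hu => ?_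
  obtain ⟨φ, -, h, hh, ⟨C, hC⟩, hinv, hlim⟩ := M.exists_subseq_tendsto_harmonic hE hψ hu
  refine ⟨φ, ?_⟩
  have hdiff := ((hlim x₁).sub (hlim x₂)).abs
  rwa [M.eq_of_harmonic_of_tightAt hFeller hcharge hh hC hinv hx₁,
    M.eq_of_harmonic_of_tightAt hFeller hcharge hh hC hinv hx₂, sub_self, abs_zero] at hdiff
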